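/- Fix a prime p. The group of 2×2 matrices with entries in ℤ[1/p] whose determinant is positive and is a unit in ℤ[1/p] (equivalently, whose determinant equals p^k for some k ∈ ℤ) is generated, as a subgroup of GL₂(ℚ), by SL₂(ℤ) together with the matrix diag(p, 1). -/

import Mathlib

open Matrix

/-- The subring `ℤ[1/p]` of `ℚ`: the subring generated by `ℤ` and `1/p`. -/
def Rp (p : ℕ) : Subring ℚ := Subring.closure {((p : ℚ))⁻¹}

/-- The image of `SL₂(ℤ)` in `GL₂(ℚ)`. -/
def SLZQ : Set (GL (Fin 2) ℚ) :=
  Set.range fun g : Matrix.SpecialLinearGroup (Fin 2) ℤ =>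
    Matrix.SpecialLinearGroup.toGL
      (Matrix.SpecialLinearGroup.map (Int.castRingHom ℚ) g)

/-- The matrix `diag(p, 1)` as an element of `GL₂(ℚ)`. -/
noncomputable def TmatQ (p : ℕ) [Fact p.Prime] : GL (Fin 2) ℚ :=
  Matrix.GeneralLinearGroup.mkOfDetNeZero (Matrix.diagonal ![(p : ℚ), 1]) (by
    have hp : (p : ℚ) ≠ 0 :=
      Nat.cast_ne_zero.mpr (Fact.out (p := p.Prime)).ne_zero
    simp [Matrix.det_diagonal, Fin.prod_univ_two, hp])

theorem zpow_mem_Rp (p : ℕ) (k : ℤ) : (p : ℚ) ^ k ∈ Rp p := by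
  have hinv : (p : ℚ)⁻¹ ∈ Rp p := Subring.subset_closure rfl
  rcases k with n | n
  · simpa using pow_mem (natCast_mem (Rp p) p) n
  · simpa [zpow_negSucc] using pow_mem hinv (n + 1)

/-- A power of `p` clears the denominator of any element of `ℤ[1/p]`. -/
theorem exists_pow_mul_eq_intCast {p : ℕ} (hp : (p : ℚ) ≠ 0) {x : ℚ} (hx : x ∈ Rp p) :
    ∃ N : ℕ, ∃ z : ℤ, (p : ℚ) ^ N * x = z := by
  induction hx using Subring.closure_induction with
  | mem x hx =>
    rw [Set.mem_singleton_iff.mp hx]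
    exact ⟨1, 1, by simp [hp]⟩
  | zero => exact ⟨0, 0, by simp⟩
  | one => exact ⟨0, 1, by simp⟩
  | add x y _ _ ihx ihy =>
    obtain ⟨N, z, hz⟩ := ihx
    obtain ⟨M, w, hw⟩ := ihy
    refine ⟨N + M, p ^ M * z + p ^ N * w, ?_⟩
    push_cast
    rw [← hz, ← hw]
    ring
  | neg x _ ih =>
    obtain ⟨N, z, hz⟩ := ih
    exact ⟨N, -z, by push_cast; rw [← hz]; ring⟩
  | mul x y _ _ ihx ihy =>
    obtain ⟨N, z, hz⟩ := ihx
    obtain ⟨M, w, hw⟩ := ihy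
    refine ⟨N + M, z * w, ?_⟩
    push_cast
    rw [← hz, ← hw]
    ring

theorem pow_mul_eq_intCast_of_le {p N M : ℕ} (h : N ≤ M) {x : ℚ}
    (hx : ∃ z : ℤ, (p : ℚ) ^ N * x = z) : ∃ z : ℤ, (p : ℚ) ^ M * x = z := by
  obtain ⟨z, hz⟩ := hx
  obtain ⟨d, rfl⟩ := Nat.exists_eq_add_of_le h
  exact ⟨p ^ d * z, by push_cast; rw [← hz]; ring⟩

theorem coe_TmatQ (p : ℕ) [Fact p.Prime] :
    (TmatQ p : Matrix (Fin 2) (Fin 2) ℚ) = !![(p : ℚ), 0; 0, 1] := by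
  ext i j
  fin_cases i <;> fin_cases j <;> simp [TmatQ, GeneralLinearGroup.mkOfDetNeZero]

theorem exists_GL_coe_eq (a b c d : ℚ) (h : a * d - b * c ≠ 0) :
    ∃ g : GL (Fin 2) ℚ, (g : Matrix (Fin 2) (Fin 2) ℚ) = !![a, b; c, d] :=
  ⟨GeneralLinearGroup.mkOfDetNeZero !![a, b; c, d] (by rwa [det_fin_two_of]), rfl⟩

theorem mem_SLZQ {g : GL (Fin 2) ℚ} {a b c d : ℤ} (h : a * d - b * c = 1)
    (hg : (g : Matrix (Fin 2) (Fin 2) ℚ) = !![(a : ℚ), b; c, d]) : g ∈ SLZQ := by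
  refine ⟨⟨!![a, b; c, d], by rwa [det_fin_two_of]⟩, ?_⟩
  apply Units.ext
  rw [hg]
  ext i j
  fin_cases i <;> fin_cases j <;> rfl

/-- A singular integer `2 × 2` matrix modulo `p` whose second row is nonzero has its first row
proportional to the second one. -/
theorem exists_dvd_row_add {p : ℤ} (hp : Prime p) {a b c d : ℤ} (h : p ∣ a * d - b * c)
    (hcd : ¬(p ∣ c ∧ p ∣ d)) : ∃ v : ℤ, p ∣ a + v * c ∧ p ∣ b + v * d := by
  have key : ∀ {a b c d : ℤ}, p ∣ a * d - b * c → ¬p ∣ c →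
      ∃ v : ℤ, p ∣ a + v * c ∧ p ∣ b + v * d := by
    intro a b c d h hc
    obtain ⟨u, w, huw⟩ := (hp.coprime_iff_not_dvd).mpr hc
    have ha : p ∣ a + -a * w * c := ⟨a * u, by linear_combination -a * huw⟩
    refine ⟨-a * w, ha, (hp.dvd_or_dvd (a := c) ?_).resolve_left hc⟩
    have : c * (b + -a * w * d) = d * (a + -a * w * c) - (a * d - b * c) := by ring
    rw [this]
    exact dvd_sub (ha.mul_left d) h
  by_cases hc : p ∣ c
  · have h' : p ∣ b * c - a * d := by rw [← neg_sub]; exact h.neg_right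
    obtain ⟨v, h1, h2⟩ := key h' fun hd => hcd ⟨hc, hd⟩
    exact ⟨v, h2, h1⟩
  · exact key h hc

/-- Integer matrices whose determinant is a power of `p` lie in the subgroup generated by
`SL₂(ℤ)` and `diag(p, 1)`. -/
theorem mem_closure_of_int (p : ℕ) [Fact p.Prime] (n : ℕ) :
    ∀ (a b c d : ℤ) (g : GL (Fin 2) ℚ), a * d - b * c = p ^ n →
      (g : Matrix (Fin 2) (Fin 2) ℚ) = !![(a : ℚ), b; c, d] →
      g ∈ Subgroup.closure (SLZQ ∪ {TmatQ p}) := by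
  have hp0 : (p : ℤ) ≠ 0 := Nat.cast_ne_zero.mpr (Fact.out (p := p.Prime)).ne_zero
  have hpp : Prime (p : ℤ) := Nat.prime_iff_prime_int.mp Fact.out
  induction n with
  | zero =>
    intro a b c d g h hg
    exact Subgroup.subset_closure (Or.inl (mem_SLZQ (by simpa using h) hg))
  | succ n ih =>
    have of_dvd_row : ∀ (a b c d : ℤ) (g : GL (Fin 2) ℚ), a * d - b * c = p ^ (n + 1) →
        (p : ℤ) ∣ a → (p : ℤ) ∣ b → (g : Matrix (Fin 2) (Fin 2) ℚ) = !![(a : ℚ), b; c, d] →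
        g ∈ Subgroup.closure (SLZQ ∪ {TmatQ p}) := by
      rintro _ _ c d g h ⟨a, rfl⟩ ⟨b, rfl⟩ hg
      have h' : a * d - b * c = p ^ n :=
        mul_left_cancel₀ hp0 (by linear_combination h)
      obtain ⟨g', hg'⟩ := exists_GL_coe_eq a b c d (by
        have : a * d - b * c ≠ 0 := by rw [h']; exact pow_ne_zero n hp0
        exact_mod_cast this)
      have : g = TmatQ p * g' := by
        apply Units.ext
        rw [Units.val_mul, coe_TmatQ, hg, hg']
        ext i j
        fin_cases i <;> fin_cases j <;> simp [Matrix.mul_apply]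
      rw [this]
      exact mul_mem (Subgroup.subset_closure (Or.inr rfl)) (ih a b c d g' h' hg')
    intro a b c d g h hg
    by_cases hcd : (p : ℤ) ∣ c ∧ (p : ℤ) ∣ d
    · obtain ⟨s, hs⟩ := exists_GL_coe_eq 0 1 (-1) 0 (by norm_num)
      have hsm : s ∈ Subgroup.closure (SLZQ ∪ {TmatQ p}) :=
        Subgroup.subset_closure (Or.inl
          (mem_SLZQ (a := 0) (b := 1) (c := -1) (d := 0) (by norm_num) (by simpa using hs)))
      refine (Subgroup.mul_mem_cancel_left _ hsm).mp
        (of_dvd_row c d (-a) (-b) _ (by linear_combination h) hcd.1 hcd.2 ?_)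
      rw [Units.val_mul, hs, hg]
      ext i j
      fin_cases i <;> fin_cases j <;> simp [Matrix.mul_apply]
    · obtain ⟨v, ha, hb⟩ := exists_dvd_row_add hpp
        (h ▸ dvd_pow_self _ n.succ_ne_zero : (p : ℤ) ∣ a * d - b * c) hcd
      obtain ⟨s, hs⟩ := exists_GL_coe_eq 1 v 0 1 (by norm_num)
      have hsm : s ∈ Subgroup.closure (SLZQ ∪ {TmatQ p}) :=
        Subgroup.subset_closure (Or.inl
          (mem_SLZQ (a := 1) (b := v) (c := 0) (d := 1) (by norm_num) (by simpa using hs)))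
      refine (Subgroup.mul_mem_cancel_left _ hsm).mp
        (of_dvd_row (a + v * c) (b + v * d) c d _ (by linear_combination h) ha hb ?_)
      rw [Units.val_mul, hs, hg]
      ext i j
      fin_cases i <;> fin_cases j <;> simp [Matrix.mul_apply]

theorem entries_mem_and_det_of_mem_closure (p : ℕ) [Fact p.Prime] {g : GL (Fin 2) ℚ}
    (hg : g ∈ Subgroup.closure (SLZQ ∪ {TmatQ p})) :
    (∀ i j, (g : Matrix (Fin 2) (Fin 2) ℚ) i j ∈ Rp p) ∧
      ∃ k : ℤ, (g : Matrix (Fin 2) (Fin 2) ℚ).det = (p : ℚ) ^ k := by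
  have hp0 : (p : ℚ) ≠ 0 := Nat.cast_ne_zero.mpr (Fact.out (p := p.Prime)).ne_zero
  induction hg using Subgroup.closure_induction with
  | mem x hx =>
    rcases hx with ⟨s, rfl⟩ | rfl
    · refine ⟨fun i j => ?_, 0, ?_⟩
      · exact intCast_mem (Rp p) (s i j)
      · rw [zpow_zero]
        exact (SpecialLinearGroup.map (Int.castRingHom ℚ) s).det_coe
    · rw [coe_TmatQ]
      refine ⟨fun i j => ?_, 1, by simp⟩
      fin_cases i <;> fin_cases j <;> simp [zero_mem, one_mem]
  | one =>
    refine ⟨fun i j => ?_, 0, by simp⟩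
    rw [Units.val_one, Matrix.one_apply]
    split_ifs
    exacts [one_mem _, zero_mem _]
  | mul x y _ _ ihx ihy =>
    obtain ⟨hx, k, hk⟩ := ihx
    obtain ⟨hy, l, hl⟩ := ihy
    refine ⟨fun i j => ?_, k + l, ?_⟩
    · rw [Units.val_mul, Matrix.mul_apply]
      exact sum_mem fun m _ => mul_mem (hx i m) (hy m j)
    · rw [Units.val_mul, det_mul, hk, hl, zpow_add₀ hp0]
  | inv x _ ih =>
    obtain ⟨hx, k, hk⟩ := ih
    rw [coe_units_inv]
    refine ⟨fun i j => ?_, -k, ?_⟩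
    · rw [Matrix.inv_def, hk, Ring.inverse_eq_inv', ← _root_.zpow_neg, Matrix.smul_apply, smul_eq_mul,
        adjugate_fin_two]
      refine mul_mem (zpow_mem_Rp p _) ?_
      fin_cases i <;> fin_cases j <;> simp [hx]
    · rw [det_nonsing_inv, hk, Ring.inverse_eq_inv', _root_.zpow_neg]

theorem mem_closure_of_entries_mem_of_det (p : ℕ) [Fact p.Prime] {g : GL (Fin 2) ℚ}
    (hg : ∀ i j, (g : Matrix (Fin 2) (Fin 2) ℚ) i j ∈ Rp p) {k : ℤ}
    (hk : (g : Matrix (Fin 2) (Fin 2) ℚ).det = (p : ℚ) ^ k) :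
    g ∈ Subgroup.closure (SLZQ ∪ {TmatQ p}) := by
  have hp0 : (p : ℚ) ≠ 0 := Nat.cast_ne_zero.mpr (Fact.out (p := p.Prime)).ne_zero
  choose N hN using fun i j => exists_pow_mul_eq_intCast hp0 (hg i j)
  obtain ⟨M, hM, hkM⟩ : ∃ M : ℕ, (∀ i j, N i j ≤ M) ∧ 0 ≤ 2 * (M : ℤ) + k := by
    refine ⟨N 0 0 + N 0 1 + N 1 0 + N 1 1 + k.natAbs, fun i j => ?_, by omega⟩
    fin_cases i <;> fin_cases j <;> simp <;> omega
  choose z hz using fun i j => pow_mul_eq_intCast_of_le (hM i j) (hN i j)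
  obtain ⟨n, hn⟩ := Int.eq_ofNat_of_zero_le hkM
  obtain ⟨s, hs⟩ := exists_GL_coe_eq ((p : ℚ) ^ M) 0 0 ((p : ℚ) ^ M) (by simp [hp0])
  have hsm : s ∈ Subgroup.closure (SLZQ ∪ {TmatQ p}) :=
    mem_closure_of_int p (2 * M) (p ^ M) 0 0 (p ^ M) s (by ring) (by simpa using hs)
  refine (Subgroup.mul_mem_cancel_left _ hsm).mp
    (mem_closure_of_int p n (z 0 0) (z 0 1) (z 1 0) (z 1 1) _ ?_ ?_)
  · have : (z 0 0 * z 1 1 - z 0 1 * z 1 0 : ℚ) = (p : ℚ) ^ n := by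
      rw [← _root_.zpow_natCast, ← hn, zpow_add₀ hp0, ← hk, det_fin_two,
        ← hz, ← hz, ← hz, ← hz, _root_.zpow_mul, _root_.zpow_natCast]
      norm_cast
      push_cast
      ring
    exact_mod_cast this
  · rw [Units.val_mul, hs]
    ext i j
    fin_cases i <;> fin_cases j <;> simp [Matrix.mul_apply, hz]

/-- The group of `2×2` matrices with entries in `ℤ[1/p]` whose determinant is positive and
a unit in `ℤ[1/p]` (equivalently, equals `p^k` for some `k ∈ ℤ`) is generated, as a
subgroup of `GL₂(ℚ)`, by `SL₂(ℤ)` together with `diag(p, 1)`. -/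
theorem stmt9 (p : ℕ) [Fact p.Prime] (g : GL (Fin 2) ℚ) :
    g ∈ Subgroup.closure (SLZQ ∪ {TmatQ p}) ↔
      ((∀ i j, (g : Matrix (Fin 2) (Fin 2) ℚ) i j ∈ Rp p) ∧
        ∃ k : ℤ, (g : Matrix (Fin 2) (Fin 2) ℚ).det = (p : ℚ) ^ k) := by
  exact ⟨entries_mem_and_det_of_mem_closure p,
    fun ⟨hg, _, hk⟩ => mem_closure_of_entries_mem_of_det p hg hk⟩
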